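/- Let M ≥ 1 be an integer, let α_k, β_k > 0 for k = 1,…,M, let m and l be nonnegative integers with l < m+1 (i.e. l ≤ m), and suppose ∑_{k=1}^M α_k > m + (1/2)(M + 3/2) and λ ≥ π·∑_{k=1}^M β_k. Then ∫_0^∞ x^{2m+1}·J_{2l}(λx)·g_M(x) dx = 0. -/

import Mathlib

open MeasureTheory Real

/-- Bessel function of the first kind of nonnegative integer order `n`. -/
noncomputable def besselJ (n : ℕ) (x : ℝ) : ℝ :=
  ∑' k : ℕ, (-1 : ℝ) ^ k / (Nat.factorial k * Nat.factorial (n + k)) * (x / 2) ^ (n + 2 * k)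

/-- The product of reciprocal Gamma functions `∏_{k<M} 1/(Γ(α k + β k x) Γ(α k - β k x))`. -/
noncomputable def gammaProd (M : ℕ) (α β : ℕ → ℝ) (x : ℝ) : ℝ :=
  ∏ k ∈ Finset.range M, (Real.Gamma (α k + β k * x) * Real.Gamma (α k - β k * x))⁻¹

/-- The entire even function `z ↦ 1 / (Γ(a + z) Γ(a - z))`. -/
noncomputable def recipGammaPair (a : ℝ) (z : ℂ) : ℂ :=
  (Complex.Gamma (a + z))⁻¹ * (Complex.Gamma (a - z))⁻¹

lemma differentiable_recipGammaPair (a : ℝ) : Differentiable ℂ (recipGammaPair a) :=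
  (Complex.differentiable_one_div_Gamma.comp (differentiable_id.const_add _)).mul
    (Complex.differentiable_one_div_Gamma.comp (differentiable_id.const_sub _))

lemma recipGammaPair_neg (a : ℝ) (z : ℂ) : recipGammaPair a (-z) = recipGammaPair a z := by
  simp only [recipGammaPair, sub_neg_eq_add, ← sub_eq_add_neg]
  ring

lemma recipGammaPair_ofReal (a x : ℝ) :
    recipGammaPair a x = (((Gamma (a + x) * Gamma (a - x))⁻¹ : ℝ) : ℂ) := by
  simp only [recipGammaPair, mul_inv]
  push_cast [← Complex.Gamma_ofReal]
  rfl

lemma norm_complex_sin_le (w : ℂ) : ‖Complex.sin w‖ ≤ rexp |w.im| := by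
  have h1 : ‖Complex.exp (-w * Complex.I)‖ ≤ rexp |w.im| := by
    rw [Complex.norm_exp]; simp [le_abs_self]
  have h2 : ‖Complex.exp (w * Complex.I)‖ ≤ rexp |w.im| := by
    rw [Complex.norm_exp]; simp [neg_le_abs]
  rw [Complex.sin, norm_div, norm_mul]
  have := norm_sub_le (Complex.exp (-w * Complex.I)) (Complex.exp (w * Complex.I))
  simp only [Complex.norm_I, mul_one, Complex.norm_ofNat]
  linarith

lemma norm_betaIntegral_le {b : ℝ} (hb : 0 < b) {u : ℂ} (hu : 1 < u.re) :
    ‖Complex.betaIntegral b u‖ ≤ (u.re - 1) ^ (-b) * Gamma b := by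
  have hr : 0 < u.re - 1 := by linarith
  have hI := integral_rpow_mul_exp_neg_mul_Ioi hb hr
  have hinteg : IntegrableOn (fun t : ℝ => t ^ (b - 1) * rexp (-((u.re - 1) * t)))
      (Set.Ioi 0) := by
    by_contra h
    rw [integral_undef h] at hI
    have : 0 < (1 / (u.re - 1)) ^ b * Gamma b := by
      have := Gamma_pos_of_pos hb
      positivity
    linarith
  have e : (u.re - 1) ^ (-b) = (1 / (u.re - 1)) ^ b := by
    rw [one_div, inv_rpow hr.le, rpow_neg hr.le]
  rw [e, ← hI, Complex.betaIntegral]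
  have hsub : Set.Ioc (0 : ℝ) 1 ⊆ Set.Ioi 0 := fun x hx => hx.1
  refine (intervalIntegral.norm_integral_le_of_norm_le (g := fun t : ℝ =>
    t ^ (b - 1) * rexp (-((u.re - 1) * t))) zero_le_one ?_ ?_).trans ?_
  · have hne : ∀ᵐ t : ℝ, t ≠ 1 := Measure.ae_ne volume 1
    filter_upwards [hne] with t ht1 ht
    have h0 : 0 < t := ht.1
    have h1 : 0 < 1 - t := sub_pos.2 (lt_of_le_of_ne ht.2 ht1)
    rw [norm_mul, Complex.norm_cpow_eq_rpow_re_of_pos h0]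
    have : (1 - (t : ℂ)) = ((1 - t : ℝ) : ℂ) := by push_cast; rfl
    rw [this, Complex.norm_cpow_eq_rpow_re_of_pos h1]
    simp only [Complex.sub_re, Complex.ofReal_re, Complex.one_re]
    gcongr
    calc (1 - t) ^ (u.re - 1) ≤ (rexp (-t)) ^ (u.re - 1) := by
          gcongr
          linarith [add_one_le_exp (-t)]
      _ = rexp (-((u.re - 1) * t)) := by rw [← exp_mul]; ring_nf
  · rw [intervalIntegrable_iff_integrableOn_Ioc_of_le zero_le_one]
    exact hinteg.mono_set hsub
  · rw [intervalIntegral.integral_of_le zero_le_one]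
    refine setIntegral_mono_set hinteg ?_ hsub.eventuallyLE
    filter_upwards [ae_restrict_mem measurableSet_Ioi] with t ht
    have : (0 : ℝ) < t := ht
    simp only [Pi.zero_apply]
    positivity

lemma norm_recipGammaPair_add_one_le {α : ℝ} (hα : 0 < α) {z : ℂ} (hz : α + 1 < z.re) :
    ‖recipGammaPair (α + 1) z‖ ≤ (z.re - α - 1) ^ (-(2 * α + 1)) * rexp (π * |z.im|) := by
  have hb : 0 < 2 * α + 1 := by linarith
  have hu : 1 < (z - α).re := by simp; linarith
  have hΓu : Complex.Gamma (z - α) ≠ 0 := Complex.Gamma_ne_zero_of_re_pos (by linarith)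
  have hΓb : Complex.Gamma ((2 * α + 1 : ℝ) : ℂ) ≠ 0 :=
    Complex.Gamma_ne_zero_of_re_pos (by simpa using hb)
  have hrefl := Complex.Gamma_mul_Gamma_one_sub (((α + 1 : ℝ) : ℂ) - z)
  have hbeta := Complex.betaIntegral_eq_Gamma_mul_div ((2 * α + 1 : ℝ) : ℂ) (z - α)
    (by simpa using hb) (by linarith)
  have e1 : 1 - (((α + 1 : ℝ) : ℂ) - z) = z - α := by push_cast; ring
  have e2 : ((2 * α + 1 : ℝ) : ℂ) + (z - α) = ((α + 1 : ℝ) : ℂ) + z := by push_cast; ring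
  rw [e1] at hrefl
  rw [e2] at hbeta
  have hinv : (Complex.Gamma (((α + 1 : ℝ) : ℂ) - z))⁻¹ =
      Complex.Gamma (z - α) * (Complex.sin (π * (((α + 1 : ℝ) : ℂ) - z)) / π) := by
    rw [← inv_div, ← hrefl, mul_inv]
    field_simp
  have key : recipGammaPair (α + 1) z = Complex.sin (π * (((α + 1 : ℝ) : ℂ) - z)) / π *
      (Complex.betaIntegral ((2 * α + 1 : ℝ) : ℂ) (z - α) /
        Complex.Gamma ((2 * α + 1 : ℝ) : ℂ)) := by
    rw [recipGammaPair, hinv, hbeta]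
    generalize Complex.Gamma ((2 * α + 1 : ℝ) : ℂ) = G at hΓb ⊢
    field_simp
  have hsin : ‖Complex.sin (π * (((α + 1 : ℝ) : ℂ) - z))‖ ≤ rexp (π * |z.im|) := by
    refine (norm_complex_sin_le _).trans (le_of_eq ?_)
    simp [abs_mul, abs_of_pos pi_pos]
  have hB := norm_betaIntegral_le hb hu
  have hΓ := Gamma_pos_of_pos hb
  rw [key, norm_mul, norm_div, norm_div, Complex.Gamma_ofReal, Complex.norm_real, Complex.norm_real,
    norm_of_nonneg pi_pos.le, norm_of_nonneg hΓ.le, mul_comm]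
  have hπ : (1 : ℝ) ≤ π := by linarith [pi_gt_three]
  gcongr
  · rw [div_le_iff₀ hΓ]
    simpa only [Complex.sub_re, Complex.ofReal_re] using hB
  · exact (div_le_self (norm_nonneg _) hπ).trans hsin

lemma recipGammaPair_shift (a : ℝ) {z : ℂ} (hz : z.im ≠ 0) :
    recipGammaPair a z = recipGammaPair a (z + 1) * ((a + z) / (a - 1 - z)) := by
  have h1 : (a : ℂ) + z ≠ 0 := fun h => hz (by simpa using congrArg Complex.im h)
  have h2 : (a : ℂ) - 1 - z ≠ 0 := fun h => hz (by simpa using congrArg Complex.im h)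
  have g1 := Complex.Gamma_add_one _ h1
  have g2 := Complex.Gamma_add_one _ h2
  have e1 : (a : ℂ) + (z + 1) = a + z + 1 := by ring
  have e2 : (a : ℂ) - (z + 1) = a - 1 - z := by ring
  have e3 : (a : ℂ) - z = a - 1 - z + 1 := by ring
  rw [recipGammaPair, recipGammaPair, e1, e2, e3, g1, g2, mul_inv, mul_inv]
  field_simp

lemma norm_recipGammaPair_le_shift (a : ℝ) (N : ℕ) {z : ℂ} (hz : 1 ≤ |z.im|) :
    ‖recipGammaPair a z‖ ≤ (1 + |2 * a - 1|) ^ N * ‖recipGammaPair a (z + N)‖ := by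
  induction N with
  | zero => simp
  | succ N ih =>
    refine ih.trans ?_
    have him : (z + N).im = z.im := by simp
    have hne : (z + N).im ≠ 0 := by
      rw [him]; intro h; rw [h] at hz; norm_num at hz
    rw [recipGammaPair_shift a hne, norm_mul, norm_div]
    have hD : 1 ≤ ‖(a : ℂ) - 1 - (z + N)‖ := by
      refine hz.trans ((Complex.abs_im_le_norm _).trans' ?_)
      simp
    have hN : ‖(a : ℂ) + (z + N)‖ ≤ (1 + |2 * a - 1|) * ‖(a : ℂ) - 1 - (z + N)‖ := by
      have : (a : ℂ) + (z + N) = ((2 * a - 1 : ℝ) : ℂ) - (a - 1 - (z + N)) := by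
        push_cast; ring
      rw [this]
      refine (norm_sub_le _ _).trans ?_
      rw [Complex.norm_real, norm_eq_abs]
      nlinarith [abs_nonneg (2 * a - 1)]
    have hQ : ‖(a : ℂ) + (z + N)‖ / ‖(a : ℂ) - 1 - (z + N)‖ ≤ 1 + |2 * a - 1| := by
      rw [div_le_iff₀ (by linarith)]; exact hN
    have e : z + ((N + 1 : ℕ) : ℂ) = z + N + 1 := by push_cast; ring
    rw [e, pow_succ]
    calc (1 + |2 * a - 1|) ^ N * (‖recipGammaPair a (z + N + 1)‖ *
          (‖(a : ℂ) + (z + N)‖ / ‖(a : ℂ) - 1 - (z + N)‖))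
        ≤ (1 + |2 * a - 1|) ^ N * (‖recipGammaPair a (z + N + 1)‖ * (1 + |2 * a - 1|)) := by
          gcongr
      _ = _ := by ring

lemma exists_norm_recipGammaPair_add_one_le {α : ℝ} (hα : 0 < α) :
    ∃ C, 0 ≤ C ∧ ∀ z : ℂ, ‖recipGammaPair (α + 1) z‖ ≤ C * rexp (π * |z.im|) := by
  have far : ∀ z : ℂ, α + 2 ≤ z.re →
      ‖recipGammaPair (α + 1) z‖ ≤ rexp (π * |z.im|) := by
    intro z hz
    refine (norm_recipGammaPair_add_one_le hα (by linarith)).trans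
      (mul_le_of_le_one_left (exp_pos _).le ?_)
    exact rpow_le_one_of_one_le_of_nonpos (by linarith) (by linarith)
  obtain ⟨N, hN⟩ := exists_nat_ge (α + 2)
  have hcomp : IsCompact (Set.Icc (0 : ℝ) (α + 2) ×ℂ Set.Icc (-1 : ℝ) 1) :=
    isCompact_Icc.reProdIm isCompact_Icc
  obtain ⟨C₀, hC₀⟩ := hcomp.exists_bound_of_continuousOn
    (differentiable_recipGammaPair (α + 1)).continuous.continuousOn
  set Q := (1 + |2 * (α + 1) - 1|) ^ N with hQ
  have hQ1 : 1 ≤ Q := one_le_pow₀ (by linarith [abs_nonneg (2 * (α + 1) - 1)])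
  have right : ∀ z : ℂ, 0 ≤ z.re →
      ‖recipGammaPair (α + 1) z‖ ≤ (Q + |C₀|) * rexp (π * |z.im|) := by
    intro z hz
    have he : 1 ≤ rexp (π * |z.im|) := one_le_exp (by positivity)
    have habs := abs_nonneg C₀
    by_cases h1 : 1 ≤ |z.im|
    · have h := norm_recipGammaPair_le_shift (α + 1) N h1
      have h' := far (z + N) (by simp; linarith)
      have : (z + N).im = z.im := by simp
      rw [this] at h'
      calc _ ≤ Q * rexp (π * |z.im|) := h.trans (by gcongr)
        _ ≤ _ := by gcongr; linarith
    · by_cases h2 : α + 2 ≤ z.re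
      · refine (far z h2).trans (le_mul_of_one_le_left (exp_pos _).le (by linarith))
      · have hmem : z ∈ Set.Icc (0 : ℝ) (α + 2) ×ℂ Set.Icc (-1 : ℝ) 1 := by
          rw [Complex.mem_reProdIm]
          push Not at h1 h2
          exact ⟨⟨hz, h2.le⟩, (abs_lt.1 h1).1.le, (abs_lt.1 h1).2.le⟩
        have := (hC₀ z hmem).trans (le_abs_self _)
        nlinarith
  refine ⟨Q + |C₀|, by positivity, fun z => ?_⟩
  rcases le_total 0 z.re with h | h
  · exact right z h
  · have := right (-z) (by simpa using h)
    simpa [recipGammaPair_neg] using this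

lemma recipGammaPair_eq_mul_add_one (a : ℝ) (z : ℂ) :
    recipGammaPair a z = (a + z) * (a - z) * recipGammaPair (a + 1) z := by
  have h : ∀ s : ℂ, (Complex.Gamma s)⁻¹ = s * (Complex.Gamma (s + 1))⁻¹ :=
    Complex.one_div_Gamma_eq_self_mul_one_div_Gamma_add_one
  rw [recipGammaPair, recipGammaPair, h (a + z), h (a - z)]
  push_cast
  ring_nf

lemma exists_norm_recipGammaPair_le {α : ℝ} (hα : 0 < α) :
    ∃ C, 0 ≤ C ∧ ∀ z : ℂ,
      ‖recipGammaPair α z‖ ≤ C * (1 + ‖z‖) ^ 2 * rexp (π * |z.im|) := by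
  obtain ⟨C, hC0, hC⟩ := exists_norm_recipGammaPair_add_one_le hα
  refine ⟨(1 + α) ^ 2 * C, by positivity, fun z => ?_⟩
  have hα' : ‖(α : ℂ)‖ = α := by rw [Complex.norm_real, norm_of_nonneg hα.le]
  have hz := norm_nonneg z
  have h1 : ‖(α : ℂ) + z‖ ≤ (1 + α) * (1 + ‖z‖) :=
    (norm_add_le _ _).trans (by rw [hα']; nlinarith)
  have h2 : ‖(α : ℂ) - z‖ ≤ (1 + α) * (1 + ‖z‖) :=
    (norm_sub_le _ _).trans (by rw [hα']; nlinarith)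
  rw [recipGammaPair_eq_mul_add_one, norm_mul, norm_mul]
  calc _ ≤ ((1 + α) * (1 + ‖z‖)) * ((1 + α) * (1 + ‖z‖)) * (C * rexp (π * |z.im|)) := by
        gcongr; exact hC z
    _ = _ := by ring

lemma exists_norm_recipGammaPair_ofReal_le {α : ℝ} (hα : 0 < α) :
    ∃ C, 0 ≤ C ∧ ∀ x : ℝ, 0 ≤ x →
      ‖recipGammaPair α (x : ℂ)‖ ≤ C * (1 + x) ^ (1 - 2 * α) := by
  have hcont : ContinuousOn (fun x : ℝ => recipGammaPair α (x : ℂ) *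
      (((1 + x) ^ (2 * α - 1) : ℝ) : ℂ)) (Set.Icc 0 (2 * α + 3)) := by
    refine ((differentiable_recipGammaPair α).continuous.comp
      Complex.continuous_ofReal).continuousOn.mul
      (Complex.continuous_ofReal.comp_continuousOn ?_)
    refine ContinuousOn.rpow_const (by fun_prop) fun x hx => Or.inl ?_
    have := hx.1
    positivity
  obtain ⟨C₀, hC₀⟩ := isCompact_Icc.exists_bound_of_continuousOn hcont
  refine ⟨|C₀| + (1 + α) ^ 2 * 3 ^ (2 * α + 1), by positivity, fun x hx => ?_⟩
  have hx1 : 0 < 1 + x := by linarith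
  have hp : 0 < (1 + x) ^ (1 - 2 * α) := rpow_pos_of_pos hx1 _
  by_cases hx2 : x ≤ 2 * α + 3
  · have h := hC₀ x ⟨hx, hx2⟩
    rw [norm_mul, Complex.norm_real, norm_of_nonneg (rpow_nonneg hx1.le _)] at h
    have e : (1 + x) ^ (1 - 2 * α) * (1 + x) ^ (2 * α - 1) = 1 := by
      rw [← rpow_add hx1]; simp
    calc ‖recipGammaPair α (x : ℂ)‖
        = ‖recipGammaPair α (x : ℂ)‖ * (1 + x) ^ (2 * α - 1) * (1 + x) ^ (1 - 2 * α) := by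
          rw [mul_assoc, mul_comm ((1 + x) ^ (2 * α - 1)), e, mul_one]
      _ ≤ |C₀| * (1 + x) ^ (1 - 2 * α) := by
          gcongr; exact h.trans (le_abs_self _)
      _ ≤ _ := by gcongr; exact le_add_of_nonneg_right (by positivity)
  · push Not at hx2
    have hb := norm_recipGammaPair_add_one_le hα (z := (x : ℂ)) (by simp; linarith)
    simp only [Complex.ofReal_re, Complex.ofReal_im, abs_zero, mul_zero, exp_zero, mul_one] at hb
    have hb2 : (x - α - 1) ^ (-(2 * α + 1)) ≤
        3 ^ (2 * α + 1) * (1 + x) ^ (-(2 * α + 1)) := by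
      have : (1 + x) / 3 ≤ x - α - 1 := by linarith
      calc (x - α - 1) ^ (-(2 * α + 1)) ≤ ((1 + x) / 3) ^ (-(2 * α + 1)) :=
            rpow_le_rpow_of_nonpos (by positivity) this (by linarith)
        _ = _ := by
            rw [div_rpow hx1.le (by norm_num), rpow_neg (by norm_num : (0 : ℝ) ≤ 3)]
            field_simp
    have hα' : ‖(α : ℂ)‖ = α := by rw [Complex.norm_real, norm_of_nonneg hα.le]
    have hx' : ‖(x : ℂ)‖ = x := by rw [Complex.norm_real, norm_of_nonneg hx]
    have h1 : ‖(α : ℂ) + x‖ ≤ (1 + α) * (1 + x) :=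
      (norm_add_le _ _).trans (by rw [hα', hx']; nlinarith)
    have h2 : ‖(α : ℂ) - x‖ ≤ (1 + α) * (1 + x) :=
      (norm_sub_le _ _).trans (by rw [hα', hx']; nlinarith)
    rw [recipGammaPair_eq_mul_add_one, norm_mul, norm_mul]
    calc _ ≤ ((1 + α) * (1 + x)) * ((1 + α) * (1 + x)) *
          (3 ^ (2 * α + 1) * (1 + x) ^ (-(2 * α + 1))) := by
          gcongr; exact hb.trans hb2
      _ = (1 + α) ^ 2 * 3 ^ (2 * α + 1) * ((1 + x) ^ 2 * (1 + x) ^ (-(2 * α + 1))) := by ring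
      _ = (1 + α) ^ 2 * 3 ^ (2 * α + 1) * (1 + x) ^ (1 - 2 * α) := by
          rw [← rpow_natCast (1 + x) 2, ← rpow_add hx1]
          congr 2; push_cast; ring
      _ ≤ _ := by gcongr; exact le_add_of_nonneg_left (abs_nonneg _)

lemma recipGammaPair_one_zero : recipGammaPair 1 0 = 1 := by
  simp [recipGammaPair]

lemma mul_recipGammaPair_one (z : ℂ) : z * recipGammaPair 1 z = Complex.sin (π * z) / π := by
  have h := Complex.Gamma_mul_Gamma_one_sub z
  rw [← inv_div, ← h, mul_inv, Complex.one_div_Gamma_eq_self_mul_one_div_Gamma_add_one z,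
    recipGammaPair]
  push_cast
  ring_nf

lemma exists_norm_recipGammaPair_one_le :
    ∃ C, 0 ≤ C ∧ ∀ z : ℂ,
      ‖recipGammaPair 1 z‖ * (1 + ‖z‖) ≤ C * rexp (π * |z.im|) := by
  obtain ⟨C₀, hC₀⟩ := (isCompact_closedBall (0 : ℂ) 1).exists_bound_of_continuousOn
    (differentiable_recipGammaPair 1).continuous.continuousOn
  refine ⟨2 * |C₀| + 2, by positivity, fun z => ?_⟩
  have he : 1 ≤ rexp (π * |z.im|) := one_le_exp (by positivity)
  have h0 := norm_nonneg (recipGammaPair 1 z)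
  have habs := abs_nonneg C₀
  rcases le_total ‖z‖ 1 with hz | hz
  · have := (hC₀ z (by simpa using hz)).trans (le_abs_self _)
    calc _ ≤ |C₀| * (1 + 1) := by gcongr
      _ ≤ _ := by nlinarith
  · have h := congrArg norm (mul_recipGammaPair_one z)
    rw [norm_mul, norm_div, Complex.norm_real, norm_of_nonneg pi_pos.le] at h
    have hs : ‖Complex.sin (π * z)‖ ≤ rexp (π * |z.im|) := by
      refine (norm_complex_sin_le _).trans (le_of_eq ?_)
      simp [abs_mul, abs_of_pos pi_pos]
    have h' : ‖z‖ * ‖recipGammaPair 1 z‖ ≤ rexp (π * |z.im|) :=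
      h.trans_le ((div_le_self (norm_nonneg _) (by linarith [pi_gt_three])).trans hs)
    nlinarith

lemma integral_cexp_int_mul (p : ℤ) :
    ∫ φ in (-π)..π, Complex.exp (p * Complex.I * φ) = if p = 0 then 2 * (π : ℂ) else 0 := by
  split_ifs with h
  · subst h
    simp
    ring
  · have hp : (p : ℂ) * Complex.I ≠ 0 := by simp [h]
    rw [integral_exp_mul_complex hp, div_eq_zero_iff]
    left
    rw [sub_eq_zero, Complex.exp_eq_exp_iff_exists_int]
    exact ⟨p, by push_cast; ring⟩

lemma integral_cexp_mul_cos_pow (n j : ℕ) :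
    ∫ φ in (-π)..π, Complex.exp (n * Complex.I * φ) * Complex.cos φ ^ j =
      ∑ q ∈ Finset.range (j + 1), if 2 * q + n = j then 2 * (π : ℂ) * (j.choose q) / 2 ^ j else 0 := by
  have h : ∀ φ : ℝ, Complex.exp (n * Complex.I * φ) * Complex.cos φ ^ j =
      ∑ q ∈ Finset.range (j + 1), ((j.choose q : ℂ) / 2 ^ j) *
        Complex.exp (((2 * q + n - j : ℤ) : ℂ) * Complex.I * φ) := by
    intro φ
    rw [Complex.cos, div_pow, add_pow, Finset.sum_div, Finset.mul_sum]
    refine Finset.sum_congr rfl fun q hq => ?_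
    have hq' : q ≤ j := Nat.lt_succ_iff.1 (Finset.mem_range.1 hq)
    rw [← Complex.exp_nat_mul, ← Complex.exp_nat_mul]
    have e : Complex.exp (((2 * q + n - j : ℤ) : ℂ) * Complex.I * φ) =
        Complex.exp (n * Complex.I * φ) * (Complex.exp (q * (φ * Complex.I)) *
          Complex.exp (((j - q : ℕ) : ℂ) * (-φ * Complex.I))) := by
      rw [← Complex.exp_add, ← Complex.exp_add]
      congr 1
      push_cast [hq']
      ring
    rw [e]
    ring
  simp_rw [h]
  rw [intervalIntegral.integral_finsetSum]
  · refine Finset.sum_congr rfl fun q hq => ?_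
    rw [intervalIntegral.integral_const_mul, integral_cexp_int_mul]
    have : (2 * (q : ℤ) + n - j = 0) ↔ 2 * q + n = j := by omega
    simp only [this]
    split_ifs <;> ring
  · intro q hq
    apply Continuous.intervalIntegrable
    fun_prop

/-- Bessel's integral for a Bessel function of even order. -/
lemma integral_cexp_cos_eq_besselJ (l : ℕ) (x : ℝ) :
    ∫ φ in (-π)..π, Complex.exp ((2 * l : ℕ) * Complex.I * φ) *
        Complex.exp (Complex.I * x * Complex.cos φ) =
      2 * π * (-1) ^ l * (besselJ (2 * l) x : ℂ) := by
  have hsum : HasSum (fun j : ℕ => ∫ φ in (-π)..π, Complex.exp ((2 * l : ℕ) * Complex.I * φ) *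
      ((Complex.I * x * Complex.cos φ) ^ j / (j.factorial : ℂ)))
      (∫ φ in (-π)..π, Complex.exp ((2 * l : ℕ) * Complex.I * φ) *
        Complex.exp (Complex.I * x * Complex.cos φ)) := by
    refine intervalIntegral.hasSum_integral_of_dominated_convergence
      (fun j _ => |x| ^ j / j.factorial) ?_ ?_ ?_ ?_ ?_
    · intro j
      apply Continuous.aestronglyMeasurable
      fun_prop
    · intro j
      refine Filter.Eventually.of_forall fun φ _ => ?_
      have h1 : ‖Complex.exp ((2 * l : ℕ) * Complex.I * φ)‖ = 1 := by
        rw [Complex.norm_exp]; simp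
      have h2 : ‖Complex.cos φ‖ ≤ 1 := by
        rw [← Complex.ofReal_cos, Complex.norm_real]; exact abs_cos_le_one φ
      rw [norm_mul, h1, one_mul, norm_div, norm_pow, norm_mul, norm_mul, Complex.norm_I, one_mul,
        Complex.norm_real, norm_eq_abs, Complex.norm_natCast]
      gcongr
      exact mul_le_of_le_one_right (abs_nonneg x) h2
    · exact Filter.Eventually.of_forall fun φ _ => Real.summable_pow_div_factorial |x|
    · exact intervalIntegrable_const
    · refine Filter.Eventually.of_forall fun φ _ => ?_
      refine HasSum.mul_left _ ?_
      rw [Complex.exp_eq_exp_ℂ]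
      simpa only [smul_eq_mul, inv_mul_eq_div] using NormedSpace.exp_series_hasSum_exp' (𝕂 := ℂ)
        (Complex.I * x * Complex.cos φ)
  have hterm : ∀ j : ℕ, ∫ φ in (-π)..π, Complex.exp ((2 * l : ℕ) * Complex.I * φ) *
      ((Complex.I * x * Complex.cos φ) ^ j / (j.factorial : ℂ)) =
      (Complex.I * x) ^ j / (j.factorial : ℂ) * ∑ q ∈ Finset.range (j + 1),
        if 2 * q + 2 * l = j then 2 * (π : ℂ) * (j.choose q) / 2 ^ j else 0 := by
    intro j
    rw [← integral_cexp_mul_cos_pow (2 * l) j, ← intervalIntegral.integral_const_mul]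
    congr 1
    ext φ
    rw [mul_pow]
    ring
  simp_rw [hterm] at hsum
  have hinj : Function.Injective fun k : ℕ => 2 * l + 2 * k := fun a b h => by
    simp only at h; omega
  rw [← hinj.hasSum_iff] at hsum
  · have hk : ∀ k : ℕ, ((fun j : ℕ => (Complex.I * x) ^ j / (j.factorial : ℂ) *
        ∑ q ∈ Finset.range (j + 1),
        if 2 * q + 2 * l = j then 2 * (π : ℂ) * (j.choose q) / 2 ^ j else 0) ∘
        fun k : ℕ => 2 * l + 2 * k) k = 2 * π * (-1) ^ l * (((-1 : ℝ) ^ k /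
          (Nat.factorial k * Nat.factorial (2 * l + k)) * (x / 2) ^ (2 * l + 2 * k) : ℝ) : ℂ) := by
      intro k
      simp only [Function.comp]
      rw [Finset.sum_eq_single k]
      · rw [if_pos (by ring)]
        have hc : ((2 * l + 2 * k).choose k : ℂ) =
            ((2 * l + 2 * k).factorial : ℂ) / (k.factorial * (2 * l + k).factorial) := by
          rw [Nat.cast_choose ℂ (by omega)]
          congr 4
          omega
        have hI : Complex.I ^ (2 * l + 2 * k) = (-1) ^ l * (-1) ^ k := by
          rw [pow_add, pow_mul, pow_mul, Complex.I_sq]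
        have hf : ((2 * l + 2 * k).factorial : ℂ) ≠ 0 := by exact_mod_cast Nat.factorial_ne_zero _
        rw [hc, mul_pow, hI]
        push_cast
        rw [div_pow]
        generalize ((2 * l + 2 * k).factorial : ℂ) = F at hf ⊢
        field_simp
      · intro q _ hq
        rw [if_neg (by omega)]
      · intro h
        exact absurd (Finset.mem_range.2 (by omega)) h
    have htsum := hsum.tsum_eq
    simp_rw [hk] at htsum
    rw [← htsum, tsum_mul_left, besselJ, Complex.ofReal_tsum]
  · intro j hj
    rw [Finset.sum_eq_zero, mul_zero]
    intro q _
    rw [if_neg]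
    intro h
    exact hj ⟨q, by simp only; omega⟩

lemma abs_besselJ_eq (l : ℕ) (x : ℝ) : |besselJ (2 * l) x| =
    ‖∫ φ in (-π)..π, Complex.exp ((2 * l : ℕ) * Complex.I * φ) *
        Complex.exp (Complex.I * x * Complex.cos φ)‖ / (2 * π) := by
  rw [integral_cexp_cos_eq_besselJ]
  simp [abs_of_pos pi_pos]

lemma continuous_besselJ (l : ℕ) : Continuous (besselJ (2 * l)) := by
  have h : besselJ (2 * l) = fun x : ℝ => (((2 * (π : ℂ) * (-1) ^ l)⁻¹ *
      ∫ φ in (-π)..π, Complex.exp ((2 * l : ℕ) * Complex.I * φ) *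
        Complex.exp (Complex.I * x * Complex.cos φ))).re := by
    ext x
    rw [integral_cexp_cos_eq_besselJ, inv_mul_cancel_left₀ (by simp [pi_ne_zero]),
      Complex.ofReal_re]
  rw [h]
  refine Complex.continuous_re.comp (continuous_const.mul ?_)
  apply intervalIntegral.continuous_parametric_intervalIntegral_of_continuous'
  fun_prop

lemma norm_cexp_int_mul_cexp_cos (n : ℤ) (x φ : ℝ) : ‖Complex.exp (n * Complex.I * φ) *
    Complex.exp (Complex.I * x * Complex.cos φ)‖ = 1 := by
  rw [norm_mul, Complex.norm_exp, Complex.norm_exp, ← Complex.ofReal_cos]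
  simp

lemma norm_integral_cexp_cos_middle_le (n : ℤ) {x δ : ℝ} (hx : 0 < x) (hδ : 0 < δ)
    (hδ' : δ ≤ π / 2) :
    ‖∫ φ in δ..(π - δ), Complex.exp (n * Complex.I * φ) *
        Complex.exp (Complex.I * x * Complex.cos φ)‖ ≤ (2 * |(n : ℝ)| + 4) / (x * sin δ) := by
  have hle : δ ≤ π - δ := by linarith
  have hsinpos : ∀ φ ∈ Set.uIcc δ (π - δ), 0 < sin φ := by
    intro φ hφ
    rw [Set.uIcc_of_le hle] at hφ
    exact sin_pos_of_pos_of_lt_pi (by linarith [hφ.1]) (by linarith [hφ.2])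
  have hsδ : 0 < sin δ := sin_pos_of_pos_of_lt_pi hδ (by linarith [pi_pos])
  have hsin : ∀ φ ∈ Set.uIcc δ (π - δ), Complex.sin φ ≠ 0 := fun φ hφ => by
    rw [← Complex.ofReal_sin]; exact_mod_cast (hsinpos φ hφ).ne'
  set c : ℂ := (-(Complex.I * x))⁻¹ with hc
  have hcn : ‖c‖ = 1 / x := by simp [hc, abs_of_pos hx]
  set u : ℝ → ℂ := fun φ => c * (Complex.exp (n * Complex.I * φ) / Complex.sin φ) with hu
  set u' : ℝ → ℂ := fun φ => c * ((n * Complex.I * Complex.exp (n * Complex.I * φ) *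
    Complex.sin φ - Complex.exp (n * Complex.I * φ) * Complex.cos φ) / Complex.sin φ ^ 2) with hu'
  set v : ℝ → ℂ := fun φ => Complex.exp (Complex.I * x * Complex.cos φ) with hv
  set v' : ℝ → ℂ := fun φ => Complex.exp (Complex.I * x * Complex.cos φ) *
    (Complex.I * x * -Complex.sin φ) with hv'
  have hdu : ∀ φ ∈ Set.uIcc δ (π - δ), HasDerivAt u (u' φ) φ := by
    intro φ hφ
    have h1 : HasDerivAt (fun z : ℂ => Complex.exp (n * Complex.I * z))
        (n * Complex.I * Complex.exp (n * Complex.I * φ)) φ := by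
      have := ((hasDerivAt_id (φ : ℂ)).const_mul (n * Complex.I)).cexp
      simpa [mul_comm] using this
    exact ((h1.div (Complex.hasDerivAt_sin φ) (hsin φ hφ)).const_mul c).comp_ofReal
  have hdv : ∀ φ ∈ Set.uIcc δ (π - δ), HasDerivAt v (v' φ) φ := by
    intro φ _
    exact ((Complex.hasDerivAt_cos φ).const_mul (Complex.I * x)).cexp.comp_ofReal
  have hu'c : ContinuousOn u' (Set.uIcc δ (π - δ)) := by
    refine ContinuousOn.mul continuousOn_const (ContinuousOn.div (by fun_prop) (by fun_prop) ?_)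
    exact fun φ hφ => pow_ne_zero 2 (hsin φ hφ)
  have hv'c : Continuous v' := by fun_prop
  have hparts := intervalIntegral.integral_mul_deriv_eq_deriv_mul hdu hdv
    hu'c.intervalIntegrable (hv'c.intervalIntegrable _ _)
  have hinteg : ∫ φ in δ..(π - δ), Complex.exp (n * Complex.I * φ) *
        Complex.exp (Complex.I * x * Complex.cos φ) = ∫ φ in δ..(π - δ), u φ * v' φ := by
    refine intervalIntegral.integral_congr fun φ hφ => ?_
    have := hsin φ hφ
    have hx' : (x : ℂ) ≠ 0 := by exact_mod_cast hx.ne'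
    simp only [hu, hv', hc]
    field_simp
  have hen : ∀ φ : ℝ, ‖Complex.exp (n * Complex.I * φ)‖ = 1 := fun φ => by
    rw [Complex.norm_exp]; simp
  have hvn : ∀ φ, ‖v φ‖ = 1 := fun φ => by
    simp only [hv]; rw [Complex.norm_exp, ← Complex.ofReal_cos]; simp
  have hun : ∀ φ ∈ Set.uIcc δ (π - δ), ‖u φ‖ = 1 / (x * sin φ) := by
    intro φ hφ
    simp only [hu]
    rw [norm_mul, norm_div, hen, hcn, ← Complex.ofReal_sin, Complex.norm_real,
      norm_of_nonneg (hsinpos φ hφ).le]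
    field_simp
  have hu'n : ∀ φ ∈ Set.uIcc δ (π - δ), ‖u' φ‖ ≤ (|(n : ℝ)| + 1) / x * (1 / sin φ ^ 2) := by
    intro φ hφ
    have hs := hsinpos φ hφ
    simp only [hu']
    rw [norm_mul, norm_div, hcn, norm_pow, ← Complex.ofReal_sin, ← Complex.ofReal_cos,
      Complex.norm_real, norm_of_nonneg hs.le]
    have hnum : ‖n * Complex.I * Complex.exp (n * Complex.I * φ) *
        (sin φ : ℂ) - Complex.exp (n * Complex.I * φ) * (cos φ : ℂ)‖ ≤ |(n : ℝ)| + 1 := by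
      refine (norm_sub_le _ _).trans ?_
      rw [norm_mul, norm_mul, norm_mul, norm_mul, hen, Complex.norm_I, Complex.norm_real,
        Complex.norm_real, Complex.norm_intCast, norm_eq_abs, norm_eq_abs]
      have h1 := abs_sin_le_one φ
      have h2 := abs_cos_le_one φ
      have h3 := abs_nonneg (n : ℝ)
      nlinarith
    calc 1 / x * (_ / sin φ ^ 2) ≤ 1 / x * ((|(n : ℝ)| + 1) / sin φ ^ 2) := by gcongr
      _ = _ := by ring
  have hcsc : ∫ φ in δ..(π - δ), 1 / sin φ ^ 2 = 2 * cos δ / sin δ := by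
    have hd : ∀ φ ∈ Set.uIcc δ (π - δ), HasDerivAt (fun φ => -(cos φ / sin φ))
        (1 / sin φ ^ 2) φ := by
      intro φ hφ
      have hs := (hsinpos φ hφ).ne'
      have := ((hasDerivAt_cos φ).div (hasDerivAt_sin φ) hs).neg
      refine this.congr_deriv ?_
      rw [show -sin φ * sin φ - cos φ * cos φ = -1 by linarith [sin_sq_add_cos_sq φ]]
      ring
    rw [intervalIntegral.integral_eq_sub_of_hasDerivAt hd]
    · rw [cos_pi_sub, sin_pi_sub]; ring
    · refine ContinuousOn.intervalIntegrable (ContinuousOn.div (by fun_prop) (by fun_prop) ?_)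
      exact fun φ hφ => pow_ne_zero 2 (hsinpos φ hφ).ne'
  have hrem : ‖∫ φ in δ..(π - δ), u' φ * v φ‖ ≤ (|(n : ℝ)| + 1) / x * (2 / sin δ) := by
    calc _ ≤ ∫ φ in δ..(π - δ), (|(n : ℝ)| + 1) / x * (1 / sin φ ^ 2) := by
          refine intervalIntegral.norm_integral_le_of_norm_le hle ?_ ?_
          · refine Filter.Eventually.of_forall fun φ hφ => ?_
            rw [norm_mul, hvn, mul_one]
            refine hu'n φ ?_
            rw [Set.uIcc_of_le hle]
            exact Set.Ioc_subset_Icc_self hφ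
          · refine ContinuousOn.intervalIntegrable (ContinuousOn.mul (by fun_prop)
              (ContinuousOn.div (by fun_prop) (by fun_prop) ?_))
            exact fun φ hφ => pow_ne_zero 2 (hsinpos φ hφ).ne'
      _ ≤ _ := by
          rw [intervalIntegral.integral_const_mul, hcsc]
          gcongr
          linarith [cos_le_one δ]
  rw [hinteg, hparts]
  have hb := hun (π - δ) Set.right_mem_uIcc
  have ha := hun δ Set.left_mem_uIcc
  rw [sin_pi_sub] at hb
  calc _ ≤ ‖u (π - δ) * v (π - δ)‖ + ‖u δ * v δ‖ + ‖∫ φ in δ..(π - δ), u' φ * v φ‖ :=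
        (norm_sub_le _ _).trans (by gcongr; exact norm_sub_le _ _)
    _ ≤ 1 / (x * sin δ) + 1 / (x * sin δ) + (|(n : ℝ)| + 1) / x * (2 / sin δ) := by
        rw [norm_mul (u (π - δ)), norm_mul (u δ), hvn, hvn, hb, ha, mul_one]
        gcongr
    _ = _ := by field_simp; ring

lemma norm_integral_cexp_cos_le (n : ℤ) {x : ℝ} (hx : 1 ≤ x) :
    ‖∫ φ in (0 : ℝ)..π, Complex.exp (n * Complex.I * φ) *
        Complex.exp (Complex.I * x * Complex.cos φ)‖ ≤ (2 + (|(n : ℝ)| + 2) * π) / √x := by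
  have hx0 : 0 < x := by linarith
  have hsq : 0 < √x := sqrt_pos.2 hx0
  have hsq1 : 1 ≤ √x := one_le_sqrt.2 hx
  set δ := 1 / √x with hδdef
  have hδ : 0 < δ := by positivity
  have hδ1 : δ ≤ 1 := by rw [hδdef, div_le_one hsq]; exact hsq1
  have hδ' : δ ≤ π / 2 := by linarith [pi_gt_three]
  have hci : ∀ a b : ℝ, IntervalIntegrable (fun φ : ℝ => Complex.exp (n * Complex.I * φ) *
        Complex.exp (Complex.I * x * Complex.cos φ)) volume a b := fun a b => by
    apply Continuous.intervalIntegrable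
    fun_prop
  have htriv : ∀ a b : ℝ, ‖∫ φ in a..b, Complex.exp (n * Complex.I * φ) *
        Complex.exp (Complex.I * x * Complex.cos φ)‖ ≤ 1 * |b - a| := fun a b =>
    intervalIntegral.norm_integral_le_of_norm_le_const fun φ _ =>
      (norm_cexp_int_mul_cexp_cos n x φ).le
  rw [← intervalIntegral.integral_add_adjacent_intervals (hci 0 δ) (hci δ π),
    ← intervalIntegral.integral_add_adjacent_intervals (hci δ (π - δ)) (hci (π - δ) π)]
  have h1 := htriv 0 δ
  have h2 := htriv (π - δ) π
  have h3 := norm_integral_cexp_cos_middle_le n hx0 hδ hδ'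
  rw [sub_zero, one_mul, abs_of_pos hδ] at h1
  rw [sub_sub_cancel, one_mul, abs_of_pos hδ] at h2
  have hsin := mul_le_sin hδ.le hδ'
  have h4 : (2 * |(n : ℝ)| + 4) / (x * sin δ) ≤ (2 * |(n : ℝ)| + 4) / (x * (2 / π * δ)) := by
    gcongr
  have h5 : (2 * |(n : ℝ)| + 4) / (x * (2 / π * δ)) = (|(n : ℝ)| + 2) * π / √x := by
    rw [hδdef]
    nth_rewrite 1 [← mul_self_sqrt hx0.le]
    field_simp
    ring
  have h6 : (2 + (|(n : ℝ)| + 2) * π) / √x = δ + δ + (|(n : ℝ)| + 2) * π / √x := by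
    rw [hδdef]; ring
  rw [h6]
  refine (norm_add_le _ _).trans ?_
  have := norm_add_le (∫ φ in δ..(π - δ), Complex.exp (n * Complex.I * φ) *
        Complex.exp (Complex.I * x * Complex.cos φ)) (∫ φ in (π - δ)..π, Complex.exp (n * Complex.I * φ) *
        Complex.exp (Complex.I * x * Complex.cos φ))
  linarith

lemma exists_abs_besselJ_le (l : ℕ) :
    ∃ C, 0 ≤ C ∧ ∀ x : ℝ, 0 ≤ x → |besselJ (2 * l) x| ≤ C * (1 + x) ^ (-(1 / 2) : ℝ) := by
  set A : ℝ := 2 + (|((2 * l : ℤ) : ℝ)| + 2) * π with hA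
  have hA0 : 2 ≤ A := by
    have : 0 ≤ (|((2 * l : ℤ) : ℝ)| + 2) * π := by positivity
    linarith
  refine ⟨2 * A, by positivity, fun x hx => ?_⟩
  have hconv : (1 + x) ^ (-(1 / 2) : ℝ) = 1 / √(1 + x) := by
    rw [rpow_neg (by linarith), ← sqrt_eq_rpow, one_div]
  have hs : 0 < √(1 + x) := sqrt_pos.2 (by linarith)
  rw [abs_besselJ_eq, hconv, div_le_iff₀ (by positivity)]
  have hcast : ((2 * l : ℕ) : ℂ) = ((2 * l : ℤ) : ℂ) := by push_cast; ring
  rw [hcast]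
  have hπ := pi_gt_three
  rcases le_total x 1 with h | h
  · have hb := intervalIntegral.norm_integral_le_of_norm_le_const (a := -π) (b := π)
      (fun φ _ => (norm_cexp_int_mul_cexp_cos (2 * l) x φ).le)
    have h2 : √(1 + x) ≤ 2 := by rw [sqrt_le_left (by norm_num)]; linarith
    have h3 : 1 / 2 ≤ 1 / √(1 + x) := by gcongr
    refine hb.trans ?_
    rw [sub_neg_eq_add, one_mul, abs_of_pos (by positivity)]
    nlinarith [mul_le_mul hA0 h3 (by norm_num) (by linarith)]
  · have hci : ∀ a b : ℝ, IntervalIntegrable (fun φ : ℝ => Complex.exp ((2 * l : ℤ) * Complex.I * φ) *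
        Complex.exp (Complex.I * x * Complex.cos φ)) volume a b := fun a b => by
      apply Continuous.intervalIntegrable
      fun_prop
    rw [← intervalIntegral.integral_add_adjacent_intervals (hci (-π) 0) (hci 0 π)]
    have h1 := norm_integral_cexp_cos_le (2 * l) h
    have h2 := norm_integral_cexp_cos_le (-(2 * l)) h
    have hneg := intervalIntegral.integral_comp_neg (a := 0) (b := π)
      (fun φ : ℝ => Complex.exp ((2 * l : ℤ) * Complex.I * φ) *
        Complex.exp (Complex.I * x * Complex.cos φ))
    rw [neg_zero] at hneg
    have hneg' : ∫ φ in (-π)..0, Complex.exp ((2 * l : ℤ) * Complex.I * φ) *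
        Complex.exp (Complex.I * x * Complex.cos φ) =
        ∫ φ in (0 : ℝ)..π, Complex.exp ((-(2 * l) : ℤ) * Complex.I * φ) *
        Complex.exp (Complex.I * x * Complex.cos φ) := by
      rw [← hneg]
      congr 1
      ext φ
      push_cast
      rw [Complex.cos_neg]
      ring_nf
    rw [hneg']
    have habs : |((-(2 * l) : ℤ) : ℝ)| = |((2 * l : ℤ) : ℝ)| := by push_cast; rw [abs_neg]
    rw [habs] at h2
    refine (norm_add_le _ _).trans ?_
    have hsx : 0 < √x := sqrt_pos.2 (by linarith)
    have h3 : √(1 + x) ≤ 2 * √x := by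
      rw [sqrt_le_left (by positivity), mul_pow, sq_sqrt (by linarith)]; linarith
    have h4 : A / √x ≤ 2 * A * (1 / √(1 + x)) := by
      rw [mul_one_div, div_le_div_iff₀ hsx hs]
      nlinarith
    have h5 : 0 ≤ 2 * A * (1 / √(1 + x)) := by positivity
    nlinarith

lemma exists_differentiable_comp_sq {G : ℂ → ℂ} (hG : Differentiable ℂ G)
    (heven : ∀ z, G (-z) = G z) :
    ∃ H : ℂ → ℂ, Differentiable ℂ H ∧ ∀ z, H (z ^ 2) = G z := by
  set r : ℂ → ℂ := fun s => s ^ (1 / 2 : ℂ) with hr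
  have hrsq : ∀ s, r s ^ 2 = s := fun s => by
    simp [hr]
  have hval : ∀ z, G (r (z ^ 2)) = G z := fun z => by
    rcases sq_eq_sq_iff_eq_or_eq_neg.1 (hrsq (z ^ 2)) with h | h
    · rw [h]
    · rw [h, heven]
  refine ⟨fun s => G (r s), ?_, hval⟩
  have hslit : ∀ s ∈ Complex.slitPlane, DifferentiableAt ℂ r s := fun s hs =>
    differentiableAt_id.cpow_const hs
  rw [← differentiableOn_univ,
    ← Complex.differentiableOn_compl_singleton_and_continuousAt_iff (c := 0) Filter.univ_mem]
  constructor
  · intro s hs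
    have hs0 : s ≠ 0 := by simpa using hs
    refine DifferentiableAt.differentiableWithinAt ?_
    by_cases h : s ∈ Complex.slitPlane
    · exact (hG _).comp s (hslit s h)
    · have h' : -s ∈ Complex.slitPlane := by
        rw [Complex.mem_slitPlane_iff] at h ⊢
        push Not at h
        left
        rw [Complex.neg_re, neg_pos]
        refine lt_of_le_of_ne h.1 fun h0 => hs0 (Complex.ext h0 h.2)
      have e : (fun s => G (r s)) = fun s => G (Complex.I * r (-s)) := by
        ext s
        have : (Complex.I * r (-s)) ^ 2 = s := by
          rw [mul_pow, hrsq, Complex.I_sq]; ring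
        rw [← hval (Complex.I * r (-s)), this]
      rw [e]
      have h1 : DifferentiableAt ℂ (fun s => r (-s)) s :=
        DifferentiableAt.comp s (hslit (-s) h') differentiableAt_id.neg
      exact (hG _).comp s (h1.const_mul _)
  · refine hG.continuous.continuousAt.comp ?_
    exact Complex.continuousAt_cpow_const_of_re_pos (by simp) (by norm_num)

lemma integral_ofReal_eq_zero_of_norm_le {f : ℂ → ℂ} (hf : Differentiable ℂ f) {C : ℝ}
    (hC : ∀ z : ℂ, 0 ≤ z.im → ‖f z‖ ≤ C * (1 + ‖z‖ ^ 2)⁻¹) :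
    ∫ x : ℝ, f x = 0 := by
  have hC0 : 0 ≤ C := by
    have := (norm_nonneg _).trans (hC 0 (by simp))
    simpa using this
  have hinteg : Integrable fun x : ℝ => f x := by
    refine (integrable_inv_one_add_sq.const_mul C).mono'
      (hf.continuous.comp Complex.continuous_ofReal).aestronglyMeasurable
      (Filter.Eventually.of_forall fun x => ?_)
    simpa using hC x (by simp)
  have hlim := intervalIntegral_tendsto_integral hinteg Filter.tendsto_neg_atTop_atBot
    Filter.tendsto_id
  refine tendsto_nhds_unique hlim ?_
  have hbd : ∀ R : ℝ, 0 < R → ‖∫ x in (-R)..R, f x‖ ≤ 4 * C / R := by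
    intro R hR
    have hsmall : ∀ z : ℂ, 0 ≤ z.im → R ≤ ‖z‖ → ‖f z‖ ≤ C * (R ^ 2)⁻¹ := by
      intro z hz hRz
      refine (hC z hz).trans ?_
      gcongr
      nlinarith
    have hrect := Complex.integral_boundary_rect_eq_zero_of_differentiableOn f (-R : ℂ)
      (R + R * Complex.I) hf.differentiableOn
    simp only [Complex.neg_re, Complex.ofReal_re, Complex.add_re, Complex.mul_re, Complex.I_re,
      mul_zero, Complex.ofReal_im, Complex.I_im, mul_one, sub_self, add_zero, Complex.neg_im,
      neg_zero, Complex.ofReal_zero, zero_mul, Complex.add_im, Complex.mul_im, zero_add,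
      smul_eq_mul] at hrect
    have htop : ‖∫ x in (-R)..R, f (x + R * Complex.I)‖ ≤ C * (R ^ 2)⁻¹ * |R - -R| :=
      intervalIntegral.norm_integral_le_of_norm_le_const fun x _ => by
        refine hsmall _ (by simp [hR.le]) ((Complex.abs_im_le_norm _).trans' ?_)
        simp [le_abs_self]
    have hside : ∀ a : ℝ, R ≤ |a| →
        ‖∫ y in (0 : ℝ)..R, f (a + y * Complex.I)‖ ≤ C * (R ^ 2)⁻¹ * |R - 0| := fun a ha =>
      intervalIntegral.norm_integral_le_of_norm_le_const fun y hy => by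
        rw [Set.uIoc_of_le hR.le] at hy
        refine hsmall _ (by simpa using hy.1.le) ((Complex.abs_re_le_norm _).trans' ?_)
        simpa using ha
    have h1 := hside R (le_abs_self R)
    have h2 := hside (-R) (by rw [abs_neg]; exact le_abs_self R)
    push_cast at h2 hrect
    rw [sub_neg_eq_add, abs_of_pos (by linarith)] at htop
    rw [sub_zero, abs_of_pos hR] at h1 h2
    have heq : ∫ x in (-R)..R, f x = (∫ x in (-R)..R, f (x + R * Complex.I)) -
        Complex.I * (∫ y in (0 : ℝ)..R, f (R + y * Complex.I)) +
        Complex.I * (∫ y in (0 : ℝ)..R, f (-R + y * Complex.I)) := by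
      linear_combination hrect
    rw [heq]
    refine (norm_add_le _ _).trans ?_
    have h3 := norm_sub_le (∫ x in (-R)..R, f (x + R * Complex.I))
      (Complex.I * (∫ y in (0 : ℝ)..R, f (R + y * Complex.I)))
    rw [norm_mul, Complex.norm_I, one_mul] at h3 ⊢
    have h4 : 4 * C / R = C * (R ^ 2)⁻¹ * (R + R) + C * (R ^ 2)⁻¹ * R + C * (R ^ 2)⁻¹ * R := by
      field_simp; ring
    linarith
  refine squeeze_zero_norm' ?_ (Filter.Tendsto.const_div_atTop Filter.tendsto_id (4 * C))
  filter_upwards [Filter.eventually_gt_atTop (0 : ℝ)] with R hR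
  simpa using hbd R hR

lemma abs_im_le_of_sq_eq {w z : ℂ} {y : ℝ} (h : w ^ 2 = z ^ 2 + (y : ℂ) ^ 2) :
    |w.im| ≤ |z.im| := by
  have hre := congrArg Complex.re h
  have him := congrArg Complex.im h
  simp only [pow_two, Complex.mul_re, Complex.mul_im, Complex.add_re, Complex.add_im,
    Complex.ofReal_re, Complex.ofReal_im] at hre him
  rw [← sq_le_sq]
  by_contra! hlt
  have hprod : w.re ^ 2 * w.im ^ 2 = z.re ^ 2 * z.im ^ 2 := by
    have : w.re * w.im = z.re * z.im := by linarith
    rw [← mul_pow, this, mul_pow]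
  have hpos : 0 < w.im ^ 2 := lt_of_le_of_lt (sq_nonneg _) hlt
  have hre' : w.re ^ 2 ≤ z.re ^ 2 := by
    refine le_of_mul_le_mul_right ?_ hpos
    rw [hprod]
    gcongr
  nlinarith [sq_nonneg y]

section PlaneTransform

variable {G H : ℂ → ℂ} {m l : ℕ} {C σ lam : ℝ}

/-- The planar function `(z + iy)^{2l} (z² + y²)^{m-l} H(z² + y²) e^{iλz}`, with `z` complex. -/
noncomputable def planeKernel (H : ℂ → ℂ) (m l : ℕ) (lam : ℝ) (z : ℂ) (y : ℝ) : ℂ :=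
  (z + Complex.I * y) ^ (2 * l) * (z ^ 2 + (y : ℂ) ^ 2) ^ (m - l) * H (z ^ 2 + (y : ℂ) ^ 2) *
    Complex.exp (Complex.I * lam * z)

lemma norm_planeKernel_le (hHG : ∀ z, H (z ^ 2) = G z)
    (hC : ∀ z, ‖G z‖ * (1 + ‖z‖) ^ (2 * m + 4) ≤ C * rexp (σ * |z.im|))
    (hσ : 0 ≤ σ) (hlam : σ ≤ lam) (hl : l ≤ m) {z : ℂ} (hz : 0 ≤ z.im) {y B : ℝ}
    (hB : ‖z + Complex.I * y‖ ^ 2 ≤ B * (1 + ‖z ^ 2 + (y : ℂ) ^ 2‖)) :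
    ‖planeKernel H m l lam z y‖ ≤ C * B ^ l * ((1 + ‖z ^ 2 + (y : ℂ) ^ 2‖) ^ 2)⁻¹ := by
  obtain ⟨w, hw⟩ := IsAlgClosed.exists_pow_nat_eq (z ^ 2 + (y : ℂ) ^ 2) two_pos
  have him := abs_im_le_of_sq_eq hw
  have hC0 : 0 ≤ C := by
    have := (by positivity : 0 ≤ ‖G 0‖ * (1 + ‖(0 : ℂ)‖) ^ (2 * m + 4)).trans (hC 0)
    simpa using this
  set s := z ^ 2 + (y : ℂ) ^ 2 with hs
  have hsn : 0 ≤ ‖s‖ := norm_nonneg s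
  have hB0 : 0 ≤ B := by
    have := (sq_nonneg _).trans hB
    exact nonneg_of_mul_nonneg_left this (by linarith)
  have hH : ‖H s‖ * (1 + ‖s‖) ^ (m + 2) ≤ C * rexp (σ * z.im) := by
    have hGw := hC w
    rw [← hHG, hw] at hGw
    have hn : 1 + ‖s‖ ≤ (1 + ‖w‖) ^ 2 := by
      rw [← hw, norm_pow]; nlinarith [norm_nonneg w]
    calc ‖H s‖ * (1 + ‖s‖) ^ (m + 2) ≤ ‖H s‖ * ((1 + ‖w‖) ^ 2) ^ (m + 2) := by gcongr
      _ = ‖H s‖ * (1 + ‖w‖) ^ (2 * m + 4) := by rw [← pow_mul]; ring_nf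
      _ ≤ _ := hGw
      _ ≤ _ := by
        gcongr
        rwa [abs_of_nonneg hz] at him
  have hexp : ‖Complex.exp (Complex.I * lam * z)‖ = rexp (-(lam * z.im)) := by
    rw [Complex.norm_exp]; congr 1; simp
  rw [planeKernel, norm_mul, norm_mul, norm_mul, norm_pow, norm_pow, hexp, pow_mul,
    ← div_eq_mul_inv, le_div_iff₀ (by positivity)]
  calc (‖z + Complex.I * y‖ ^ 2) ^ l * ‖s‖ ^ (m - l) * ‖H s‖ * rexp (-(lam * z.im)) *
        (1 + ‖s‖) ^ 2
      ≤ (B * (1 + ‖s‖)) ^ l * (1 + ‖s‖) ^ (m - l) * ‖H s‖ * rexp (-(σ * z.im)) *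
        (1 + ‖s‖) ^ 2 := by
        gcongr
        linarith
    _ = B ^ l * (‖H s‖ * ((1 + ‖s‖) ^ l * (1 + ‖s‖) ^ (m - l) * (1 + ‖s‖) ^ 2)) *
        rexp (-(σ * z.im)) := by rw [mul_pow]; ring
    _ = B ^ l * (‖H s‖ * (1 + ‖s‖) ^ (m + 2)) * rexp (-(σ * z.im)) := by
        rw [← pow_add, ← pow_add, Nat.add_sub_cancel' hl]
    _ ≤ B ^ l * (C * rexp (σ * z.im)) * rexp (-(σ * z.im)) := by gcongr
    _ = C * B ^ l * (rexp (σ * z.im) * rexp (-(σ * z.im))) := by ring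
    _ = C * B ^ l := by rw [← exp_add]; simp

lemma integral_planeKernel_eq_zero (hH : Differentiable ℂ H) (hHG : ∀ z, H (z ^ 2) = G z)
    (hC : ∀ z, ‖G z‖ * (1 + ‖z‖) ^ (2 * m + 4) ≤ C * rexp (σ * |z.im|))
    (hσ : 0 ≤ σ) (hlam : σ ≤ lam) (hl : l ≤ m) (y : ℝ) :
    ∫ x : ℝ, planeKernel H m l lam x y = 0 := by
  have hC0 : 0 ≤ C := by
    have := (by positivity : 0 ≤ ‖G 0‖ * (1 + ‖(0 : ℂ)‖) ^ (2 * m + 4)).trans (hC 0)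
    simpa using this
  refine integral_ofReal_eq_zero_of_norm_le (f := fun z => planeKernel H m l lam z y)
    (C := C * (4 * (1 + y ^ 2)) ^ l * (1 + y ^ 2)) ?_ fun z hz => ?_
  · unfold planeKernel
    have : Differentiable ℂ fun z : ℂ => H (z ^ 2 + (y : ℂ) ^ 2) := hH.comp (by fun_prop)
    fun_prop
  have hsq : ‖z‖ ^ 2 ≤ ‖z ^ 2 + (y : ℂ) ^ 2‖ + y ^ 2 := by
    have := norm_sub_le (z ^ 2 + (y : ℂ) ^ 2) ((y : ℂ) ^ 2)
    rw [add_sub_cancel_right, norm_pow, norm_pow, Complex.norm_real, norm_eq_abs, sq_abs] at this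
    exact this
  have hsn := norm_nonneg (z ^ 2 + (y : ℂ) ^ 2)
  have hB : ‖z + Complex.I * y‖ ^ 2 ≤ 4 * (1 + y ^ 2) * (1 + ‖z ^ 2 + (y : ℂ) ^ 2‖) := by
    have h1 : ‖z + Complex.I * y‖ ≤ ‖z‖ + |y| := by
      refine (norm_add_le _ _).trans ?_
      simp
    have h2 : ‖z + Complex.I * y‖ ^ 2 ≤ (‖z‖ + |y|) ^ 2 := by gcongr
    have h3 := sq_abs y
    nlinarith [sq_nonneg (‖z‖ - |y|), mul_nonneg (sq_nonneg y) hsn]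
  refine (norm_planeKernel_le hHG hC hσ hlam hl hz hB).trans ?_
  have h5 : 1 + ‖z‖ ^ 2 ≤ (1 + y ^ 2) * (1 + ‖z ^ 2 + (y : ℂ) ^ 2‖) ^ 2 := by
    nlinarith [mul_nonneg (sq_nonneg y) hsn, mul_nonneg (sq_nonneg y) (sq_nonneg ‖z ^ 2 + (y : ℂ) ^ 2‖)]
  rw [mul_assoc (C * _)]
  gcongr
  rw [← div_eq_mul_inv, le_div_iff₀ (by positivity), inv_mul_le_iff₀ (by positivity)]
  linarith

lemma continuous_planeKernel (hH : Differentiable ℂ H) :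
    Continuous fun p : ℝ × ℝ => planeKernel H m l lam p.1 p.2 := by
  unfold planeKernel
  have := hH.continuous
  fun_prop

lemma integrable_planeKernel (hH : Differentiable ℂ H) (hHG : ∀ z, H (z ^ 2) = G z)
    (hC : ∀ z, ‖G z‖ * (1 + ‖z‖) ^ (2 * m + 4) ≤ C * rexp (σ * |z.im|))
    (hσ : 0 ≤ σ) (hlam : σ ≤ lam) (hl : l ≤ m) :
    Integrable fun p : ℝ × ℝ => planeKernel H m l lam p.1 p.2 := by
  have hC0 : 0 ≤ C := by
    have := (by positivity : 0 ≤ ‖G 0‖ * (1 + ‖(0 : ℂ)‖) ^ (2 * m + 4)).trans (hC 0)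
    simpa using this
  refine ((integrable_inv_one_add_sq.mul_prod integrable_inv_one_add_sq).const_mul C).mono'
    (continuous_planeKernel hH).aestronglyMeasurable (Filter.Eventually.of_forall fun p => ?_)
  obtain ⟨x, y⟩ := p
  have hs : ‖(x : ℂ) ^ 2 + (y : ℂ) ^ 2‖ = x ^ 2 + y ^ 2 := by
    rw [← Complex.ofReal_pow, ← Complex.ofReal_pow, ← Complex.ofReal_add, Complex.norm_real,
      norm_of_nonneg (by positivity)]
  have hB : ‖(x : ℂ) + Complex.I * y‖ ^ 2 ≤ 1 * (1 + ‖(x : ℂ) ^ 2 + (y : ℂ) ^ 2‖) := by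
    rw [mul_comm Complex.I, Complex.sq_norm, Complex.normSq_add_mul_I, hs]
    linarith
  refine (norm_planeKernel_le hHG hC hσ hlam hl (by simp) hB).trans ?_
  rw [one_pow, mul_one, hs, ← mul_inv]
  gcongr
  nlinarith [sq_nonneg x, sq_nonneg y, sq_nonneg (x * y)]

lemma planeKernel_polar (hHG : ∀ z, H (z ^ 2) = G z) (hl : l ≤ m) (r θ : ℝ) :
    planeKernel H m l lam ((r * cos θ : ℝ) : ℂ) (r * sin θ) =
      (r : ℂ) ^ (2 * m) * G r * (Complex.exp ((2 * l : ℕ) * Complex.I * θ) *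
        Complex.exp (Complex.I * (lam * r : ℝ) * Complex.cos θ)) := by
  have h1 : ((r * cos θ : ℝ) : ℂ) + Complex.I * ((r * sin θ : ℝ) : ℂ) =
      r * Complex.exp (Complex.I * θ) := by
    rw [mul_comm Complex.I (θ : ℂ), Complex.exp_mul_I]; push_cast; ring
  have h2 : ((r * cos θ : ℝ) : ℂ) ^ 2 + ((r * sin θ : ℝ) : ℂ) ^ 2 = (r : ℂ) ^ 2 := by
    push_cast
    linear_combination (r : ℂ) ^ 2 * Complex.sin_sq_add_cos_sq θ
  rw [planeKernel, h1, h2, hHG, mul_pow, ← Complex.exp_nat_mul, ← pow_mul]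
  have h3 : (r : ℂ) ^ (2 * m) = (r : ℂ) ^ (2 * l) * (r : ℂ) ^ (2 * (m - l)) := by
    rw [← pow_add]; congr 1; omega
  rw [h3, ← mul_assoc ((2 * l : ℕ) : ℂ)]
  push_cast
  ring_nf

lemma integrableOn_planeKernel_polar (hH : Differentiable ℂ H) (hHG : ∀ z, H (z ^ 2) = G z)
    (hC : ∀ z, ‖G z‖ * (1 + ‖z‖) ^ (2 * m + 4) ≤ C * rexp (σ * |z.im|)) (hl : l ≤ m) :
    IntegrableOn (fun p : ℝ × ℝ => p.1 •
      planeKernel H m l lam ((p.1 * cos p.2 : ℝ) : ℂ) (p.1 * sin p.2))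
      (Set.Ioi (0 : ℝ) ×ˢ Set.Ioo (-π) π) (volume.prod volume) := by
  have hC0 : 0 ≤ C := by
    have := (by positivity : 0 ≤ ‖G 0‖ * (1 + ‖(0 : ℂ)‖) ^ (2 * m + 4)).trans (hC 0)
    simpa using this
  have hdom : Integrable (fun p : ℝ × ℝ => C * ((1 + p.1 ^ 2)⁻¹ * 1))
      ((volume.prod volume).restrict (Set.Ioi (0 : ℝ) ×ˢ Set.Ioo (-π) π)) := by
    rw [← Measure.prod_restrict]
    have hr : Integrable (fun r : ℝ => (1 + r ^ 2)⁻¹) (volume.restrict (Set.Ioi 0)) :=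
      integrable_inv_one_add_sq.restrict
    have hθ : Integrable (fun _ : ℝ => (1 : ℝ)) (volume.restrict (Set.Ioo (-π) π)) :=
      integrable_const _
    exact (hr.mul_prod hθ).const_mul C
  refine hdom.mono' ?_ ?_
  · apply Continuous.aestronglyMeasurable
    unfold planeKernel
    have := hH.continuous
    fun_prop
  · filter_upwards [ae_restrict_mem (measurableSet_Ioi.prod measurableSet_Ioo)] with p hp
    obtain ⟨r, θ⟩ := p
    have hr : 0 < r := hp.1
    have hGr := hC r
    rw [Complex.norm_real, norm_of_nonneg hr.le, Complex.ofReal_im, abs_zero, mul_zero, exp_zero,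
      mul_one] at hGr
    have hn := norm_cexp_int_mul_cexp_cos (2 * l) (lam * r) θ
    push_cast at hn
    simp only
    rw [planeKernel_polar hHG hl, norm_smul, norm_mul, norm_mul]
    push_cast
    rw [hn, norm_pow, Complex.norm_real, norm_of_nonneg hr.le, mul_one, mul_one,
      ← div_eq_mul_inv, le_div_iff₀ (by positivity)]
    refine hGr.trans' ?_
    calc r * (r ^ (2 * m) * ‖G r‖) * (1 + r ^ 2)
        = ‖G r‖ * (r ^ (2 * m + 1) * (1 + r ^ 2)) := by ring
      _ ≤ ‖G r‖ * ((1 + r) ^ (2 * m + 1) * (1 + r) ^ 3) := by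
          gcongr
          · linarith
          · nlinarith [pow_pos hr 3, pow_pos hr 2]
      _ = _ := by rw [← pow_add]

/-- The Hankel transform of even order `2l ≤ 2m` of `x^{2m} G(x)`, with `G` even, entire and of
exponential type at most `σ`, vanishes from `σ` on. -/
lemma integral_besselJ_eq_zero_of_even (hG : Differentiable ℂ G) (heven : ∀ z, G (-z) = G z)
    (hC : ∀ z, ‖G z‖ * (1 + ‖z‖) ^ (2 * m + 4) ≤ C * rexp (σ * |z.im|))
    (hσ : 0 ≤ σ) (hlam : σ ≤ lam) (hl : l ≤ m) :
    ∫ x in Set.Ioi (0 : ℝ), (x : ℂ) ^ (2 * m + 1) * (besselJ (2 * l) (lam * x) : ℂ) * G x = 0 := by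
  obtain ⟨H, hH, hHG⟩ := exists_differentiable_comp_sq hG heven
  have hplane : ∫ p : ℝ × ℝ, planeKernel H m l lam p.1 p.2 = 0 := by
    rw [Measure.volume_eq_prod, integral_prod_symm _ (integrable_planeKernel hH hHG hC hσ hlam hl)]
    simp only
    simp_rw [integral_planeKernel_eq_zero hH hHG hC hσ hlam hl]
    simp
  have hpolar := integral_comp_polarCoord_symm fun p : ℝ × ℝ => planeKernel H m l lam p.1 p.2
  rw [hplane] at hpolar
  simp only [polarCoord_symm_apply, polarCoord_target] at hpolar
  have hinteg := integrableOn_planeKernel_polar (lam := lam) hH hHG hC hl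
  rw [Measure.volume_eq_prod, setIntegral_prod _ hinteg] at hpolar
  have hinner : ∀ r : ℝ, ∫ θ in Set.Ioo (-π) π, r •
      planeKernel H m l lam ((r * cos θ : ℝ) : ℂ) (r * sin θ) =
      2 * π * (-1) ^ l * ((r : ℂ) ^ (2 * m + 1) * (besselJ (2 * l) (lam * r) : ℂ) * G r) := by
    intro r
    simp_rw [planeKernel_polar hHG hl]
    rw [← integral_Ioc_eq_integral_Ioo, ← intervalIntegral.integral_of_le (by linarith [pi_pos])]
    simp_rw [Complex.real_smul, ← mul_assoc (r : ℂ)]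
    rw [intervalIntegral.integral_const_mul, integral_cexp_cos_eq_besselJ]
    ring
  simp only [hinner] at hpolar
  rw [integral_const_mul] at hpolar
  exact (mul_eq_zero.1 hpolar).resolve_left (by simp [pi_ne_zero])

end PlaneTransform

lemma exists_one_add_mul_rpow_le {b : ℝ} (hb : 0 < b) (p : ℝ) :
    ∃ C, 0 ≤ C ∧ ∀ x : ℝ, 0 ≤ x → (1 + b * x) ^ p ≤ C * (1 + x) ^ p := by
  rcases le_total 0 p with hp | hp
  · refine ⟨(1 + b) ^ p, by positivity, fun x hx => ?_⟩
    rw [← mul_rpow (by positivity) (by positivity)]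
    refine rpow_le_rpow (by positivity) ?_ hp
    nlinarith
  · have hc : 0 < min 1 b := lt_min one_pos hb
    refine ⟨(min 1 b) ^ p, by positivity, fun x hx => ?_⟩
    rw [← mul_rpow hc.le (by positivity)]
    refine rpow_le_rpow_of_nonpos (by positivity) ?_ hp
    nlinarith [min_le_left 1 b, mul_le_mul_of_nonneg_right (min_le_right 1 b) hx]

/-- The entire extension of `gammaProd`. -/
noncomputable def complexGammaProd (M : ℕ) (α β : ℕ → ℝ) (z : ℂ) : ℂ :=
  ∏ k ∈ Finset.range M, recipGammaPair (α k) (β k * z)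

lemma complexGammaProd_ofReal (M : ℕ) (α β : ℕ → ℝ) (x : ℝ) :
    complexGammaProd M α β x = (gammaProd M α β x : ℂ) := by
  rw [complexGammaProd, gammaProd, Complex.ofReal_prod]
  refine Finset.prod_congr rfl fun k _ => ?_
  rw [← Complex.ofReal_mul, recipGammaPair_ofReal]

lemma differentiable_complexGammaProd (M : ℕ) (α β : ℕ → ℝ) :
    Differentiable ℂ (complexGammaProd M α β) := by
  unfold complexGammaProd
  refine Differentiable.fun_finsetProd fun k _ => ?_
  exact (differentiable_recipGammaPair (α k)).comp (by fun_prop)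

lemma complexGammaProd_neg (M : ℕ) (α β : ℕ → ℝ) (z : ℂ) :
    complexGammaProd M α β (-z) = complexGammaProd M α β z := by
  simp [complexGammaProd, recipGammaPair_neg]

lemma exists_norm_complexGammaProd_le {M : ℕ} {α β : ℕ → ℝ}
    (hα : ∀ k ∈ Finset.range M, 0 < α k) (hβ : ∀ k ∈ Finset.range M, 0 < β k) :
    ∃ C, 0 ≤ C ∧ ∀ z : ℂ, ‖complexGammaProd M α β z‖ ≤
      C * (1 + ‖z‖) ^ (2 * M) * rexp (π * (∑ k ∈ Finset.range M, β k) * |z.im|) := by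
  have hfac : ∀ k, ∃ C, 0 ≤ C ∧ (k ∈ Finset.range M → ∀ z : ℂ,
      ‖recipGammaPair (α k) (β k * z)‖ ≤ C * (1 + ‖z‖) ^ 2 * rexp (π * β k * |z.im|)) := by
    intro k
    by_cases hk : k ∈ Finset.range M
    · obtain ⟨C, hC0, hC⟩ := exists_norm_recipGammaPair_le (hα k hk)
      have hb := hβ k hk
      refine ⟨C * (1 + β k) ^ 2, by positivity, fun _ z => (hC _).trans ?_⟩
      have h1 : ‖(β k : ℂ) * z‖ = β k * ‖z‖ := by
        rw [norm_mul, Complex.norm_real, norm_of_nonneg hb.le]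
      have h2 : |((β k : ℂ) * z).im| = β k * |z.im| := by simp [abs_mul, abs_of_pos hb]
      have h3 : 1 + β k * ‖z‖ ≤ (1 + β k) * (1 + ‖z‖) := by nlinarith [norm_nonneg z]
      rw [h1, h2, ← mul_assoc π]
      calc C * (1 + β k * ‖z‖) ^ 2 * rexp (π * β k * |z.im|)
          ≤ C * ((1 + β k) * (1 + ‖z‖)) ^ 2 * rexp (π * β k * |z.im|) := by gcongr
        _ = _ := by ring
    · exact ⟨0, le_rfl, fun h => absurd h hk⟩
  choose C hC0 hC using hfac
  refine ⟨∏ k ∈ Finset.range M, C k, Finset.prod_nonneg fun k _ => hC0 k, fun z => ?_⟩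
  rw [complexGammaProd, norm_prod]
  calc _ ≤ ∏ k ∈ Finset.range M, C k * (1 + ‖z‖) ^ 2 * rexp (π * β k * |z.im|) :=
        Finset.prod_le_prod (fun _ _ => norm_nonneg _) fun k hk => hC k hk z
    _ = _ := by
        rw [Finset.prod_mul_distrib, Finset.prod_mul_distrib, Finset.prod_const, Finset.card_range,
          ← exp_sum, ← pow_mul, Finset.mul_sum, Finset.sum_mul]

lemma exists_norm_complexGammaProd_ofReal_le {M : ℕ} {α β : ℕ → ℝ}
    (hα : ∀ k ∈ Finset.range M, 0 < α k) (hβ : ∀ k ∈ Finset.range M, 0 < β k) :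
    ∃ C, 0 ≤ C ∧ ∀ x : ℝ, 0 ≤ x → ‖complexGammaProd M α β (x : ℂ)‖ ≤
      C * (1 + x) ^ (M - 2 * ∑ k ∈ Finset.range M, α k) := by
  have hfac : ∀ k, ∃ C, 0 ≤ C ∧ (k ∈ Finset.range M → ∀ x : ℝ, 0 ≤ x →
      ‖recipGammaPair (α k) (β k * (x : ℂ))‖ ≤ C * (1 + x) ^ (1 - 2 * α k)) := by
    intro k
    by_cases hk : k ∈ Finset.range M
    · obtain ⟨C, hC0, hC⟩ := exists_norm_recipGammaPair_ofReal_le (hα k hk)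
      obtain ⟨D, hD0, hD⟩ := exists_one_add_mul_rpow_le (hβ k hk) (1 - 2 * α k)
      refine ⟨C * D, by positivity, fun _ x hx => ?_⟩
      have h := hC (β k * x) (mul_nonneg (hβ k hk).le hx)
      rw [Complex.ofReal_mul] at h
      rw [mul_assoc]
      exact h.trans (mul_le_mul_of_nonneg_left (hD x hx) hC0)
    · exact ⟨0, le_rfl, fun h => absurd h hk⟩
  choose C hC0 hC using hfac
  refine ⟨∏ k ∈ Finset.range M, C k, Finset.prod_nonneg fun k _ => hC0 k, fun x hx => ?_⟩
  rw [complexGammaProd, norm_prod]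
  calc _ ≤ ∏ k ∈ Finset.range M, C k * (1 + x) ^ (1 - 2 * α k) :=
        Finset.prod_le_prod (fun _ _ => norm_nonneg _) fun k hk => hC k hk x hx
    _ = _ := by
        rw [Finset.prod_mul_distrib, ← rpow_sum_of_pos (by linarith), Finset.sum_sub_distrib,
          ← Finset.mul_sum]
        simp

/-- The vanishing of the Hankel transform after multiplication by a power of
`sin(πεx)/(πεx)`. -/
lemma integral_besselJ_mul_complexGammaProd_mul_eq_zero {M : ℕ} {α β : ℕ → ℝ}
    (hα : ∀ k ∈ Finset.range M, 0 < α k) (hβ : ∀ k ∈ Finset.range M, 0 < β k)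
    {m l : ℕ} (hl : l ≤ m) {ε lam : ℝ} (hε : 0 < ε)
    (hlam : π * (∑ k ∈ Finset.range M, β k) + (2 * M + 2 * m + 4 : ℕ) * (π * ε) ≤ lam) :
    ∫ x in Set.Ioi (0 : ℝ), (x : ℂ) ^ (2 * m + 1) * (besselJ (2 * l) (lam * x) : ℂ) *
      (complexGammaProd M α β x * recipGammaPair 1 (ε * (x : ℂ)) ^ (2 * M + 2 * m + 4)) = 0 := by
  obtain ⟨A, hA0, hA⟩ := exists_norm_complexGammaProd_le hα hβ
  obtain ⟨B, hB0, hB⟩ := exists_norm_recipGammaPair_one_le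
  have hsum : 0 ≤ ∑ k ∈ Finset.range M, β k := Finset.sum_nonneg fun k hk => (hβ k hk).le
  set D := B * (1 + 1 / ε) with hD
  have hS : ∀ z : ℂ, ‖recipGammaPair 1 (ε * z)‖ * (1 + ‖z‖) ≤ D * rexp (π * ε * |z.im|) := by
    intro z
    have h := hB (ε * z)
    have h1 : ‖(ε : ℂ) * z‖ = ε * ‖z‖ := by
      rw [norm_mul, Complex.norm_real, norm_of_nonneg hε.le]
    have h2 : |((ε : ℂ) * z).im| = ε * |z.im| := by simp [abs_mul, abs_of_pos hε]
    rw [h1, h2, ← mul_assoc π] at h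
    have h3 : 1 + ‖z‖ ≤ (1 + ε * ‖z‖) * (1 + 1 / ε) := by
      have : (1 + ε * ‖z‖) * (1 + 1 / ε) = 1 + ‖z‖ + (ε * ‖z‖ + 1 / ε) := by
        field_simp; ring
      rw [this]
      exact le_add_of_nonneg_right (by positivity)
    calc _ ≤ ‖recipGammaPair 1 (ε * z)‖ * ((1 + ε * ‖z‖) * (1 + 1 / ε)) := by gcongr
      _ = (‖recipGammaPair 1 (ε * z)‖ * (1 + ε * ‖z‖)) * (1 + 1 / ε) := by ring
      _ ≤ (B * rexp (π * ε * |z.im|)) * (1 + 1 / ε) := by gcongr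
      _ = _ := by rw [hD]; ring
  refine integral_besselJ_eq_zero_of_even
    (G := fun z => complexGammaProd M α β z * recipGammaPair 1 (ε * z) ^ (2 * M + 2 * m + 4))
    (C := A * D ^ (2 * M + 2 * m + 4))
    (σ := π * (∑ k ∈ Finset.range M, β k) + (2 * M + 2 * m + 4 : ℕ) * (π * ε))
    ?_ ?_ ?_ (by positivity) hlam hl
  · refine (differentiable_complexGammaProd M α β).mul (Differentiable.pow ?_ _)
    exact (differentiable_recipGammaPair 1).comp (by fun_prop)
  · intro z
    simp only [complexGammaProd_neg, mul_neg, recipGammaPair_neg]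
  · intro z
    simp only [norm_mul, norm_pow]
    have hz : 0 < 1 + ‖z‖ := by positivity
    refine le_of_mul_le_mul_right ?_ (pow_pos hz (2 * M))
    calc ‖complexGammaProd M α β z‖ * ‖recipGammaPair 1 (ε * z)‖ ^ (2 * M + 2 * m + 4) *
          (1 + ‖z‖) ^ (2 * m + 4) * (1 + ‖z‖) ^ (2 * M)
        = ‖complexGammaProd M α β z‖ *
          (‖recipGammaPair 1 (ε * z)‖ * (1 + ‖z‖)) ^ (2 * M + 2 * m + 4) := by
          rw [mul_pow]; ring
      _ ≤ (A * (1 + ‖z‖) ^ (2 * M) * rexp (π * (∑ k ∈ Finset.range M, β k) * |z.im|)) *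
          (D * rexp (π * ε * |z.im|)) ^ (2 * M + 2 * m + 4) :=
          mul_le_mul (hA z) (pow_le_pow_left₀ (by positivity) (hS z) _) (by positivity)
            (by positivity)
      _ = _ := by
          rw [mul_pow, ← exp_nat_mul, add_mul, exp_add]
          ring_nf

theorem hankel_gamma_vanishes_even_order
    (M : ℕ) (hM : 1 ≤ M) (α β : ℕ → ℝ)
    (hα : ∀ k ∈ Finset.range M, 0 < α k) (hβ : ∀ k ∈ Finset.range M, 0 < β k)
    (m l : ℕ) (hl : l < m + 1)
    (hαsum : (m : ℝ) + (1 / 2) * ((M : ℝ) + 3 / 2) < ∑ k ∈ Finset.range M, α k)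
    (lam : ℝ) (hlam : π * ∑ k ∈ Finset.range M, β k ≤ lam) :
    ∫ x in Set.Ioi (0 : ℝ), x ^ (2 * m + 1) * besselJ (2 * l) (lam * x) * gammaProd M α β x
      = 0 := by
  have hlam0 : 0 < lam := by
    refine lt_of_lt_of_le (mul_pos pi_pos (Finset.sum_pos hβ ?_)) hlam
    exact Finset.nonempty_range_iff.2 (by omega)
  set K := 2 * M + 2 * m + 4 with hK
  set ε : ℕ → ℝ := fun n => 1 / ((n : ℝ) + 1) with hε
  have hεpos : ∀ n, 0 < ε n := fun n => by positivity
  have hεlim : Filter.Tendsto ε Filter.atTop (nhds 0) := tendsto_one_div_add_atTop_nhds_zero_nat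
  set F : ℕ → ℝ → ℂ := fun n x => (x : ℂ) ^ (2 * m + 1) *
    (besselJ (2 * l) ((lam + K * (π * ε n)) * x) : ℂ) *
    (complexGammaProd M α β x * recipGammaPair 1 (ε n * (x : ℂ)) ^ K) with hF
  have hzero : ∀ n, ∫ x in Set.Ioi (0 : ℝ), F n x = 0 := fun n =>
    integral_besselJ_mul_complexGammaProd_mul_eq_zero hα hβ (Nat.lt_succ_iff.1 hl) (hεpos n)
      (by linarith)
  obtain ⟨A, hA0, hA⟩ := exists_norm_complexGammaProd_ofReal_le hα hβ
  obtain ⟨B, hB0, hB⟩ := exists_norm_recipGammaPair_one_le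
  obtain ⟨C, hC0, hC⟩ := exists_abs_besselJ_le l
  obtain ⟨D, hD0, hD⟩ := exists_one_add_mul_rpow_le hlam0 (-(1 / 2))
  set p : ℝ := (2 * m + 1 : ℕ) + -(1 / 2) + (M - 2 * ∑ k ∈ Finset.range M, α k) with hp
  have hp1 : p < -1 := by rw [hp]; push_cast; linarith
  have hgcont := (differentiable_complexGammaProd M α β).continuous
  have hscont := (differentiable_recipGammaPair 1).continuous
  have hJcont := continuous_besselJ l
  have hlim : Filter.Tendsto (fun n => ∫ x in Set.Ioi (0 : ℝ), F n x) Filter.atTop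
      (nhds (∫ x in Set.Ioi (0 : ℝ), (x : ℂ) ^ (2 * m + 1) *
        (besselJ (2 * l) (lam * x) : ℂ) * complexGammaProd M α β x)) := by
    refine tendsto_integral_of_dominated_convergence
      (fun x => C * D * A * B ^ K * (x + 1) ^ p) (fun n => ?_) ?_ (fun n => ?_) ?_
    · apply Continuous.aestronglyMeasurable
      simp only [hF]
      fun_prop
    · exact (integrableOn_add_rpow_Ioi_of_lt hp1 (by norm_num)).const_mul _
    · filter_upwards [ae_restrict_mem measurableSet_Ioi] with x hx
      have hx0 : 0 ≤ x := le_of_lt hx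
      have hx1 : 0 < 1 + x := by linarith
      have hJ : |besselJ (2 * l) ((lam + K * (π * ε n)) * x)| ≤
          C * D * (1 + x) ^ (-(1 / 2) : ℝ) := by
        have hεn := hεpos n
        refine (hC _ (by positivity)).trans ?_
        rw [mul_assoc C]
        gcongr
        refine (hD x hx0).trans' (rpow_le_rpow_of_nonpos (by positivity) ?_ (by norm_num))
        gcongr
        exact le_add_of_nonneg_right (by positivity)
      have hS : ‖recipGammaPair 1 (ε n * (x : ℂ))‖ ≤ B := by
        have h := hB (ε n * (x : ℂ))
        have him : ((ε n : ℂ) * x).im = 0 := by simp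
        rw [him, abs_zero, mul_zero, exp_zero, mul_one] at h
        exact h.trans' (le_mul_of_one_le_right (norm_nonneg _)
          (le_add_of_nonneg_right (norm_nonneg _)))
      simp only [hF]
      rw [norm_mul, norm_mul, norm_mul, norm_pow, norm_pow, Complex.norm_real, Complex.norm_real,
        norm_of_nonneg hx0, norm_eq_abs]
      calc _ ≤ (1 + x) ^ (2 * m + 1) * (C * D * (1 + x) ^ (-(1 / 2) : ℝ)) *
            (A * (1 + x) ^ (M - 2 * ∑ k ∈ Finset.range M, α k) * B ^ K) := by
            gcongr
            · linarith
            · exact hA x hx0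
        _ = C * D * A * B ^ K * ((1 + x) ^ (2 * m + 1) * (1 + x) ^ (-(1 / 2) : ℝ) *
            (1 + x) ^ (M - 2 * ∑ k ∈ Finset.range M, α k)) := by ring
        _ = _ := by
            rw [← rpow_natCast (1 + x), ← rpow_add hx1, ← rpow_add hx1, add_comm x 1]
    · refine Filter.Eventually.of_forall fun x => ?_
      have h1 : Filter.Tendsto (fun n => (lam + K * (π * ε n)) * x) Filter.atTop
          (nhds ((lam + K * (π * 0)) * x)) :=
        (((hεlim.const_mul π).const_mul (K : ℝ)).const_add lam).mul_const x
      have h2 : Filter.Tendsto (fun n => (ε n : ℂ) * x) Filter.atTop (nhds (((0 : ℝ) : ℂ) * x)) :=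
        ((Complex.continuous_ofReal.tendsto 0).comp hεlim).mul_const _
      have h3 := ((Complex.continuous_ofReal.comp hJcont).tendsto _).comp h1
      have h4 := ((hscont.tendsto _).comp h2).pow K
      simp only [mul_zero, add_zero, Complex.ofReal_zero, zero_mul, recipGammaPair_one_zero,
        one_pow] at h3 h4
      simpa using (h3.const_mul ((x : ℂ) ^ (2 * m + 1))).mul
        (h4.const_mul (complexGammaProd M α β x))
  simp only [hzero] at hlim
  have hfinal := tendsto_nhds_unique hlim tendsto_const_nhds
  simp only [complexGammaProd_ofReal] at hfinal
  rw [← Complex.ofReal_inj, ← integral_complex_ofReal, Complex.ofReal_zero, ← hfinal]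
  push_cast
  rfl
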